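/- Let A ∈ ℝ^{2n×2n} be symmetric positive definite with symplectic eigenvalues 0 < d₁ ≤ … ≤ d_n, let 1 ≤ p ≤ n and β > d_p, and suppose X ∈ ℝ^{2n×2p} is a first-order stationary point of f_β (AX − βJ_nX(XᵀJ_nX − J_p) = 0) that is not a global minimizer of f_β. Then there exists Y ∈ ℝ^{2n×2p} such that the Hessian quadratic form tr(YᵀAY) − β·tr((YᵀJ_nY)(XᵀJ_nX − J_p)) + (β/2)‖YᵀJ_nX + XᵀJ_nY‖_F² is strictly negative; in particular X is not a local minimizer of f_β. -/

import Mathlib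

open Matrix BigOperators

noncomputable section

/-- The Poisson matrix `J_k = [[0, I],[-I, 0]]`, on index type `Fin k ⊕ Fin k`
(representing dimension `2k`). -/
def Jmat (k : ℕ) : Matrix (Fin k ⊕ Fin k) (Fin k ⊕ Fin k) ℝ :=
  Matrix.fromBlocks 0 1 (-1) 0

/-- Squared Frobenius norm `‖M‖_F² = tr(Mᵀ M)`. -/
def frobSq {m k : Type*} [Fintype m] [Fintype k] (M : Matrix m k ℝ) : ℝ :=
  Matrix.trace (Mᵀ * M)

/-- The Frobenius norm. -/
def frobNorm {m k : Type*} [Fintype m] [Fintype k] (M : Matrix m k ℝ) : ℝ :=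
  Real.sqrt (frobSq M)

/-- The trace-penalty function `f_β`. -/
def fPen (n p : ℕ) (A : Matrix (Fin n ⊕ Fin n) (Fin n ⊕ Fin n) ℝ) (β : ℝ)
    (X : Matrix (Fin n ⊕ Fin n) (Fin p ⊕ Fin p) ℝ) : ℝ :=
  (1 / 2) * Matrix.trace (Xᵀ * A * X) + (β / 4) * frobSq (Xᵀ * Jmat n * X - Jmat p)

/-- The gradient `∇f_β(X) = AX - βJ_nX(XᵀJ_nX - J_p)`. -/
def gradPen (n p : ℕ) (A : Matrix (Fin n ⊕ Fin n) (Fin n ⊕ Fin n) ℝ) (β : ℝ)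
    (X : Matrix (Fin n ⊕ Fin n) (Fin p ⊕ Fin p) ℝ) :
    Matrix (Fin n ⊕ Fin n) (Fin p ⊕ Fin p) ℝ :=
  A * X - β • (Jmat n * X * (Xᵀ * Jmat n * X - Jmat p))

/-- The Hessian quadratic form of `fPen` at `X` in the direction `Y`. -/
def hessPen (n p : ℕ) (A : Matrix (Fin n ⊕ Fin n) (Fin n ⊕ Fin n) ℝ) (β : ℝ)
    (X Y : Matrix (Fin n ⊕ Fin n) (Fin p ⊕ Fin p) ℝ) : ℝ :=
  Matrix.trace (Yᵀ * A * Y)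
    - β * Matrix.trace ((Yᵀ * Jmat n * Y) * (Xᵀ * Jmat n * X - Jmat p))
    + (β / 2) * frobSq (Yᵀ * Jmat n * X + Xᵀ * Jmat n * Y)

lemma Jmat_transpose (k : ℕ) : (Jmat k)ᵀ = -Jmat k := by
  simp [Jmat, Matrix.fromBlocks_transpose, Matrix.fromBlocks_neg]

lemma Jmat_mul_self (k : ℕ) : Jmat k * Jmat k = -1 := by
  simp [Jmat, Matrix.fromBlocks_multiply, ← Matrix.fromBlocks_one, Matrix.fromBlocks_neg]

lemma Jmat_mul_Jmat_mul {k : ℕ} {m : Type*} (M : Matrix (Fin k ⊕ Fin k) m ℝ) :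
    Jmat k * (Jmat k * M) = -M := by
  rw [← Matrix.mul_assoc, Jmat_mul_self, Matrix.neg_mul, Matrix.one_mul]

lemma diagonal_mul_Jmat {n : ℕ} (d : Fin n → ℝ) :
    diagonal (Sum.elim d d) * Jmat n = Jmat n * diagonal (Sum.elim d d) := by
  rw [Jmat, ← Matrix.fromBlocks_diagonal, Matrix.fromBlocks_multiply,
    Matrix.fromBlocks_multiply]
  simp only [Matrix.mul_zero, Matrix.zero_mul, Matrix.mul_one, Matrix.one_mul, add_zero,
    zero_add, Matrix.mul_neg, Matrix.neg_mul, neg_zero]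

lemma frobSq_eq_sum {m k : Type*} [Fintype m] [Fintype k] (M : Matrix m k ℝ) :
    frobSq M = ∑ i, ∑ j, M i j ^ 2 := by
  rw [Finset.sum_comm]
  simp [frobSq, Matrix.trace, Matrix.mul_apply, sq]

lemma frobSq_nonneg {m k : Type*} [Fintype m] [Fintype k] (M : Matrix m k ℝ) :
    0 ≤ frobSq M := by
  rw [frobSq_eq_sum]; positivity

lemma frobSq_eq_zero {m k : Type*} [Fintype m] [Fintype k] {M : Matrix m k ℝ}
    (h : frobSq M = 0) : M = 0 := by
  rw [frobSq, ← Matrix.conjTranspose_eq_transpose_of_trivial] at h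
  exact Matrix.trace_conjTranspose_mul_self_eq_zero_iff.1 h

lemma trace_transpose_diagonal_mul {m k : Type*} [Fintype m] [DecidableEq m] [Fintype k]
    (δ : m → ℝ) (M : Matrix m k ℝ) :
    trace (Mᵀ * diagonal δ * M) = ∑ i, ∑ j, δ i * M i j ^ 2 := by
  rw [Finset.sum_comm]
  simp only [Matrix.trace, Matrix.diag, Matrix.mul_apply (M := Mᵀ * diagonal δ),
    Matrix.mul_diagonal, Matrix.transpose_apply]
  exact Finset.sum_congr rfl fun _ _ => Finset.sum_congr rfl fun _ _ => by ring

lemma fPen_add_smul {n p : ℕ} {A : Matrix (Fin n ⊕ Fin n) (Fin n ⊕ Fin n) ℝ} (hA : Aᵀ = A)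
    (β : ℝ) (X Y : Matrix (Fin n ⊕ Fin n) (Fin p ⊕ Fin p) ℝ) (t : ℝ) :
    fPen n p A β (X + t • Y) = fPen n p A β X + t * trace (Yᵀ * gradPen n p A β X)
      + t ^ 2 * (hessPen n p A β X Y / 2)
      + t ^ 3 * (β / 2 * trace ((Yᵀ * Jmat n * X + Xᵀ * Jmat n * Y)ᵀ * (Yᵀ * Jmat n * Y)))
      + t ^ 4 * (β / 4 * frobSq (Yᵀ * Jmat n * Y)) := by
  have hW : ∃ W, W = Xᵀ * Jmat n * X - Jmat p := ⟨_, rfl⟩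
  obtain ⟨W, hW⟩ := hW
  have hWt : Wᵀ = -W := by
    rw [hW]; simp [Jmat_transpose, Matrix.mul_assoc]; abel
  obtain ⟨B, hB⟩ : ∃ B, B = Yᵀ * Jmat n * X + Xᵀ * Jmat n * Y := ⟨_, rfl⟩
  obtain ⟨C, hC⟩ : ∃ C, C = Yᵀ * Jmat n * Y := ⟨_, rfl⟩
  have h1 : (X + t • Y)ᵀ * Jmat n * (X + t • Y) - Jmat p = W + t • B + t ^ 2 • C := by
    rw [hW, hB, hC]
    simp only [Matrix.transpose_add, Matrix.transpose_smul, Matrix.add_mul, Matrix.mul_add,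
      Matrix.smul_mul, Matrix.mul_smul]
    module
  have h2 : trace ((X + t • Y)ᵀ * A * (X + t • Y)) = trace (Xᵀ * A * X)
      + 2 * t * trace (Yᵀ * A * X) + t ^ 2 * trace (Yᵀ * A * Y) := by
    have : trace (Xᵀ * A * Y) = trace (Yᵀ * A * X) := by
      rw [← Matrix.trace_transpose]; simp [hA, Matrix.mul_assoc]
    simp only [Matrix.transpose_add, Matrix.transpose_smul, Matrix.add_mul, Matrix.mul_add,
      Matrix.smul_mul, Matrix.mul_smul, Matrix.trace_add, Matrix.trace_smul, this, smul_eq_mul]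
    ring
  have h3 : trace (Wᵀ * B) = -2 * trace (Yᵀ * Jmat n * X * W) := by
    have e1 : trace (W * (Yᵀ * Jmat n * X)) = trace (Yᵀ * Jmat n * X * W) :=
      Matrix.trace_mul_comm _ _
    have e2 : trace (W * (Xᵀ * Jmat n * Y)) = trace (Yᵀ * Jmat n * X * W) := by
      rw [← Matrix.trace_transpose]; simp [hWt, Jmat_transpose, Matrix.mul_assoc]
    rw [hWt, hB, Matrix.neg_mul, Matrix.trace_neg, Matrix.mul_add, Matrix.trace_add, e1, e2]
    ring
  have h4 : trace (Wᵀ * C) = - trace (C * W) := by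
    rw [hWt, Matrix.neg_mul, Matrix.trace_neg, Matrix.trace_mul_comm]
  have h5 : frobSq (W + t • B + t ^ 2 • C) = frobSq W + 2 * t * trace (Wᵀ * B)
      + t ^ 2 * (frobSq B + 2 * trace (Wᵀ * C)) + 2 * t ^ 3 * trace (Bᵀ * C)
      + t ^ 4 * frobSq C := by
    have e1 : trace (Bᵀ * W) = trace (Wᵀ * B) := by
      rw [← Matrix.trace_transpose]; simp
    have e2 : trace (Cᵀ * W) = trace (Wᵀ * C) := by
      rw [← Matrix.trace_transpose]; simp
    have e3 : trace (Cᵀ * B) = trace (Bᵀ * C) := by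
      rw [← Matrix.trace_transpose]; simp
    simp only [frobSq, Matrix.transpose_add, Matrix.transpose_smul, Matrix.add_mul,
      Matrix.mul_add, Matrix.smul_mul, Matrix.mul_smul, Matrix.trace_add, Matrix.trace_smul,
      e1, e2, e3, smul_eq_mul]
    ring
  have h6 : trace (Yᵀ * gradPen n p A β X)
      = trace (Yᵀ * A * X) - β * trace (Yᵀ * Jmat n * X * W) := by
    rw [gradPen, ← hW, Matrix.mul_sub, Matrix.trace_sub, Matrix.mul_smul, Matrix.trace_smul,
      smul_eq_mul]
    simp only [Matrix.mul_assoc]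
  rw [fPen, h1, h2, h5, h6, hessPen, fPen, ← hW, ← hB, ← hC, h3, h4]
  ring

lemma quartic_coeff {a b c e : ℝ}
    (h : ∀ᶠ t in nhds (0 : ℝ), 0 ≤ t * a + t ^ 2 * b + t ^ 3 * c + t ^ 4 * e) :
    a = 0 ∧ 0 ≤ b := by
  have key : ∀ {a b c : ℝ},
      (∀ᶠ t in nhdsWithin (0 : ℝ) (Set.Ioi 0), 0 ≤ a + t * b + t ^ 2 * c) → 0 ≤ a := by
    intro a b c h
    have hc : Filter.Tendsto (fun t : ℝ => a + t * b + t ^ 2 * c)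
        (nhdsWithin (0 : ℝ) (Set.Ioi 0)) (nhds a) := by
      have : Continuous fun t : ℝ => a + t * b + t ^ 2 * c := by fun_prop
      simpa using (this.tendsto 0).mono_left nhdsWithin_le_nhds
    exact ge_of_tendsto hc h
  have hlin : ∀ {a b c e : ℝ},
      (∀ᶠ t in nhds (0 : ℝ), 0 ≤ t * a + t ^ 2 * b + t ^ 3 * c + t ^ 4 * e) → 0 ≤ a := by
    intro a b c e h
    have hc : Filter.Tendsto (fun t : ℝ => a + t * b + t ^ 2 * c + t ^ 3 * e)
        (nhdsWithin (0 : ℝ) (Set.Ioi 0)) (nhds a) := by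
      have : Continuous fun t : ℝ => a + t * b + t ^ 2 * c + t ^ 3 * e := by fun_prop
      simpa using (this.tendsto 0).mono_left nhdsWithin_le_nhds
    refine ge_of_tendsto hc ?_
    filter_upwards [h.filter_mono nhdsWithin_le_nhds, self_mem_nhdsWithin] with t ht htp
    exact nonneg_of_mul_nonneg_right (by linarith) (Set.mem_Ioi.1 htp)
  have ha : a = 0 := by
    refine le_antisymm ?_ (hlin h)
    have hneg : ∀ᶠ t in nhds (0 : ℝ),
        0 ≤ t * (-a) + t ^ 2 * b + t ^ 3 * (-c) + t ^ 4 * e := by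
      have hn : Filter.Tendsto (fun t : ℝ => -t) (nhds 0) (nhds 0) := by
        simpa using (continuous_neg (G := ℝ)).tendsto 0
      filter_upwards [hn.eventually h] with t ht
      linarith
    linarith [hlin hneg]
  refine ⟨ha, key (b := c) (c := e) ?_⟩
  filter_upwards [h.filter_mono nhdsWithin_le_nhds, self_mem_nhdsWithin] with t ht htp
  have : 0 < t ^ 2 := pow_pos htp 2
  refine nonneg_of_mul_nonneg_right (a := t ^ 2) ?_ this
  rw [ha] at ht
  linarith

lemma IsLocalMin.fPen_conditions {n p : ℕ} {A : Matrix (Fin n ⊕ Fin n) (Fin n ⊕ Fin n) ℝ}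
    (hA : Aᵀ = A) {β : ℝ} {X : Matrix (Fin n ⊕ Fin n) (Fin p ⊕ Fin p) ℝ}
    (h : IsLocalMin (fPen n p A β) X) :
    gradPen n p A β X = 0 ∧ ∀ Y, 0 ≤ hessPen n p A β X Y := by
  have key : ∀ Y, trace (Yᵀ * gradPen n p A β X) = 0 ∧ 0 ≤ hessPen n p A β X Y / 2 := by
    intro Y
    have hc : Filter.Tendsto (fun t : ℝ => X + t • Y) (nhds 0) (nhds X) := by
      have : Continuous fun t : ℝ => X + t • Y := by fun_prop
      simpa using this.tendsto 0
    refine quartic_coeff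
      (c := β / 2 * trace ((Yᵀ * Jmat n * X + Xᵀ * Jmat n * Y)ᵀ * (Yᵀ * Jmat n * Y)))
      (e := β / 4 * frobSq (Yᵀ * Jmat n * Y)) ?_
    filter_upwards [hc.eventually h] with t ht
    rw [fPen_add_smul hA] at ht
    linarith
  exact ⟨frobSq_eq_zero (key _).1, fun Y => by linarith [(key Y).2]⟩

lemma exists_forall_fPen_diagonal_le {n p : ℕ} {β : ℝ} (hβ : 0 ≤ β) {δ : Fin n ⊕ Fin n → ℝ}
    (hδ : ∀ i, 0 < δ i) :
    ∃ Z, ∀ Y, fPen n p (diagonal δ) β Z ≤ fPen n p (diagonal δ) β Y := by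
  have hlow : ∀ (Y : Matrix (Fin n ⊕ Fin n) (Fin p ⊕ Fin p) ℝ) i j,
      δ i * Y i j ^ 2 ≤ 2 * fPen n p (diagonal δ) β Y := by
    intro Y i j
    have h1 : δ i * Y i j ^ 2 ≤ trace (Yᵀ * diagonal δ * Y) := by
      rw [trace_transpose_diagonal_mul]
      have hnn : ∀ a b, 0 ≤ δ a * Y a b ^ 2 := fun a b =>
        mul_nonneg (hδ a).le (sq_nonneg _)
      exact (Finset.single_le_sum (f := fun b => δ i * Y i b ^ 2) (fun b _ => hnn i b)
        (Finset.mem_univ j)).trans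
        (Finset.single_le_sum (f := fun a => ∑ b, δ a * Y a b ^ 2)
          (fun a _ => Finset.sum_nonneg fun b _ => hnn a b) (Finset.mem_univ i))
    have h2 := mul_nonneg hβ (frobSq_nonneg (Yᵀ * Jmat n * Y - Jmat p))
    rw [fPen]
    linarith
  have hcont : Continuous (fPen n p (diagonal δ) β) := by
    unfold fPen frobSq
    fun_prop
  let R : Fin n ⊕ Fin n → ℝ := fun i => 2 * fPen n p (diagonal δ) β 0 / δ i + 1
  let K : Set (Matrix (Fin n ⊕ Fin n) (Fin p ⊕ Fin p) ℝ) :=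
    Set.pi Set.univ fun i => Set.pi Set.univ fun _ => Set.Icc (-R i) (R i)
  have hK : IsCompact K := isCompact_univ_pi fun i => isCompact_univ_pi fun _ => isCompact_Icc
  have hR : ∀ i, 1 ≤ R i := by
    intro i
    have : 0 ≤ fPen n p (diagonal δ) β 0 := by
      have := mul_nonneg hβ (frobSq_nonneg ((0 : Matrix (Fin n ⊕ Fin n) (Fin p ⊕ Fin p) ℝ)ᵀ
        * Jmat n * (0 : Matrix (Fin n ⊕ Fin n) (Fin p ⊕ Fin p) ℝ) - Jmat p))
      rw [fPen]
      simp only [Matrix.mul_zero, Matrix.trace_zero] at this ⊢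
      linarith
    have := div_nonneg (mul_nonneg zero_le_two this) (hδ i).le
    simp only [R]
    linarith
  have h0 : (0 : Matrix (Fin n ⊕ Fin n) (Fin p ⊕ Fin p) ℝ) ∈ K := by
    intro i _ j _
    have := hR i
    simp only [Matrix.zero_apply, Set.mem_Icc]
    constructor <;> linarith
  obtain ⟨Z, -, hZ⟩ := hK.exists_isMinOn ⟨0, h0⟩ hcont.continuousOn
  refine ⟨Z, fun Y => ?_⟩
  by_cases hY : Y ∈ K
  · exact hZ hY
  · refine (hZ h0).trans ?_
    by_contra hlt
    refine hY fun i _ j _ => ?_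
    rw [Set.mem_Icc, ← abs_le]
    have h1 := hlow Y i j
    have h2 : Y i j ^ 2 ≤ R i := by
      have : Y i j ^ 2 ≤ 2 * fPen n p (diagonal δ) β 0 / δ i := by
        rw [le_div_iff₀ (hδ i)]
        linarith
      simp only [R]
      linarith
    have h3 : Y i j ^ 2 ≤ R i ^ 2 := by nlinarith [hR i]
    exact abs_le_of_sq_le_sq h3 (by linarith [hR i])

lemma Jmat_comm_of_stationary {n p : ℕ} {d : Fin n → ℝ} (hd : ∀ i, 0 < d i) {β : ℝ}
    (hβ : 0 < β) {Z : Matrix (Fin n ⊕ Fin n) (Fin p ⊕ Fin p) ℝ}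
    (hst : gradPen n p (diagonal (Sum.elim d d)) β Z = 0) :
    Jmat n * Z = Z * Jmat p := by
  have hδ : ∀ i, 0 < Sum.elim d d i := by rintro (i | i) <;> exact hd i
  set D := diagonal (Sum.elim d d) with hD
  have hDJ : D * Jmat n = Jmat n * D := diagonal_mul_Jmat d
  obtain ⟨J, hJ⟩ : ∃ J, J = Jmat n := ⟨_, rfl⟩
  obtain ⟨j, hj⟩ : ∃ j, j = Jmat p := ⟨_, rfl⟩
  have hJt : Jᵀ = -J := hJ ▸ Jmat_transpose n
  have hjt : jᵀ = -j := hj ▸ Jmat_transpose p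
  have hJJ : J * J = -1 := hJ ▸ Jmat_mul_self n
  have hjj : j * j = -1 := hj ▸ Jmat_mul_self p
  obtain ⟨M, hM⟩ : ∃ M, M = Zᵀ * J * Z := ⟨_, rfl⟩
  rw [gradPen, ← hJ, ← hj, ← hM, sub_eq_zero] at hst
  rw [← hJ] at hDJ ⊢
  rw [← hj]
  have hMt : Mᵀ = -M := by rw [hM]; simp [hJt, Matrix.mul_assoc]
  have hq : Zᵀ * D * Z = β • (M * (M - j)) := by
    rw [Matrix.mul_assoc, hst, hM]
    simp only [Matrix.mul_smul, Matrix.mul_assoc]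
  have hcomm : M * j = j * M := by
    have h1 : (Zᵀ * D * Z)ᵀ = Zᵀ * D * Z := by simp [hD, Matrix.mul_assoc]
    rw [hq, Matrix.transpose_smul, Matrix.transpose_mul, Matrix.transpose_sub, hMt, hjt] at h1
    have h2 := smul_right_injective _ hβ.ne' h1
    beta_reduce at h2
    have h3 : M * M - j * M = M * M - M * j := by
      rw [← Matrix.mul_sub, ← h2]; noncomm_ring
    exact (sub_right_injective h3).symm
  obtain ⟨T, hT⟩ : ∃ T, T = 1 + j * M := ⟨_, rfl⟩
  have hTt : Tᵀ = T := by rw [hT]; simp [hMt, hjt, hcomm]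
  have hTpsd : T.PosSemidef := by
    have h1 : (T - T * T).PosSemidef := by
      have : T - T * T = β⁻¹ • (Zᵀ * D * Z) := by
        rw [hq, smul_smul, inv_mul_cancel₀ hβ.ne', one_smul, hT]
        have : j * M * (j * M) = - (M * M) := by
          rw [Matrix.mul_assoc, ← Matrix.mul_assoc M, hcomm, Matrix.mul_assoc,
            ← Matrix.mul_assoc j, hjj]
          simp
        simp only [Matrix.add_mul, Matrix.mul_add, Matrix.mul_one, Matrix.one_mul, this,
          Matrix.mul_sub, hcomm]
        abel
      rw [this]
      have hDp : D.PosSemidef := Matrix.PosSemidef.diagonal fun i => (hδ i).le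
      have := hDp.conjTranspose_mul_mul_same Z
      rw [Matrix.conjTranspose_eq_transpose_of_trivial] at this
      exact this.smul (inv_nonneg.2 hβ.le)
    have h2 : (T * T).PosSemidef := by
      have := Matrix.posSemidef_conjTranspose_mul_self T
      rwa [Matrix.conjTranspose_eq_transpose_of_trivial, hTt] at this
    simpa using h1.add h2
  obtain ⟨N, hN⟩ : ∃ N, N = Z + J * Z * j := ⟨_, rfl⟩
  have hWj : (M - j) * j = j * (M - j) := by rw [Matrix.sub_mul, Matrix.mul_sub, hcomm]
  have hTW : T = j * (M - j) := by rw [hT, Matrix.mul_sub, hjj]; abel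
  have hDN : D * N = -(β • (N * T)) := by
    have e1 : D * (J * Z * j) = -(β • (Z * (j * (M - j)))) := by
      rw [← Matrix.mul_assoc, ← Matrix.mul_assoc, hDJ, Matrix.mul_assoc J, hst]
      simp only [Matrix.mul_smul, Matrix.smul_mul, ← hWj]
      rw [← Matrix.mul_assoc, ← Matrix.mul_assoc, hJJ]
      simp [Matrix.mul_assoc]
    have e2 : N * T = Z * (j * (M - j)) - J * Z * (M - j) := by
      rw [hN, hTW, Matrix.add_mul, Matrix.mul_assoc (J * Z) j, ← Matrix.mul_assoc j, hjj,
        Matrix.neg_mul, Matrix.one_mul, Matrix.mul_neg, sub_eq_add_neg (Z * _)]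
    rw [e2, hN, Matrix.mul_add, hst, e1, smul_sub]
    abel
  have hzero : trace (Nᵀ * D * N) ≤ 0 := by
    have h1 : 0 ≤ trace (N * T * Nᵀ) := by
      have := (hTpsd.mul_mul_conjTranspose_same N).trace_nonneg
      rwa [Matrix.conjTranspose_eq_transpose_of_trivial] at this
    rw [Matrix.mul_assoc, hDN, Matrix.mul_neg, Matrix.mul_smul, Matrix.trace_neg,
      Matrix.trace_smul, Matrix.trace_mul_comm, smul_eq_mul]
    linarith [mul_nonneg hβ.le h1]
  have hN0 : N = 0 := by
    rw [hD, trace_transpose_diagonal_mul] at hzero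
    have hnn : ∀ a b, 0 ≤ Sum.elim d d a * N a b ^ 2 := fun a b =>
      mul_nonneg (hδ a).le (sq_nonneg _)
    have h0 := le_antisymm hzero (Finset.sum_nonneg fun a _ => Finset.sum_nonneg fun b _ => hnn a b)
    ext a b
    have h1 := (Finset.sum_eq_zero_iff_of_nonneg
      fun a _ => Finset.sum_nonneg fun b _ => hnn a b).1 h0 a (Finset.mem_univ a)
    have h2 := (Finset.sum_eq_zero_iff_of_nonneg fun b _ => hnn a b).1 h1 b (Finset.mem_univ b)
    simpa [(hδ a).ne'] using h2
  have h1 : N * j = 0 := by rw [hN0, Matrix.zero_mul]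
  rw [hN, Matrix.add_mul, Matrix.mul_assoc (J * Z), hjj, Matrix.mul_neg, Matrix.mul_one] at h1
  exact (sub_eq_zero.1 (by rw [sub_eq_add_neg]; exact h1)).symm

section JmatComm

variable {n p : ℕ} {Z : Matrix (Fin n ⊕ Fin n) (Fin p ⊕ Fin p) ℝ}

lemma transpose_mul_Jmat (hZ : Jmat n * Z = Z * Jmat p) :
    Zᵀ * Jmat n = Jmat p * Zᵀ := by
  have := congrArg Matrix.transpose hZ
  simpa [Jmat_transpose] using this

lemma penalty_eq_of_comm (hZ : Jmat n * Z = Z * Jmat p) :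
    Zᵀ * Jmat n * Z - Jmat p = Jmat p * (Zᵀ * Z - 1) := by
  rw [transpose_mul_Jmat hZ, Matrix.mul_sub, Matrix.mul_assoc, Matrix.mul_one]

lemma mul_eq_of_stationary {A : Matrix (Fin n ⊕ Fin n) (Fin n ⊕ Fin n) ℝ} {β : ℝ}
    (hZ : Jmat n * Z = Z * Jmat p) (hst : gradPen n p A β Z = 0) :
    A * Z = β • (Z * (1 - Zᵀ * Z)) := by
  rw [gradPen, penalty_eq_of_comm hZ, hZ, sub_eq_zero] at hst
  rw [hst, Matrix.mul_assoc Z, Jmat_mul_Jmat_mul, neg_sub]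

lemma fPen_of_stationary {A : Matrix (Fin n ⊕ Fin n) (Fin n ⊕ Fin n) ℝ} {β : ℝ}
    (hZ : Jmat n * Z = Z * Jmat p) (hst : gradPen n p A β Z = 0) :
    fPen n p A β Z = β / 2 * p - β / 4 * trace (Zᵀ * Z * (Zᵀ * Z)) := by
  have h1 : Zᵀ * A * Z = β • (Zᵀ * Z * (1 - Zᵀ * Z)) := by
    rw [Matrix.mul_assoc, mul_eq_of_stationary hZ hst, Matrix.mul_smul, Matrix.mul_assoc]
  have h2 : frobSq (Jmat p * (Zᵀ * Z - 1)) = trace ((Zᵀ * Z - 1) * (Zᵀ * Z - 1)) := by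
    rw [frobSq, Matrix.transpose_mul, Matrix.mul_assoc, Jmat_transpose, Matrix.neg_mul,
      Jmat_mul_Jmat_mul]
    simp
  rw [fPen, penalty_eq_of_comm hZ, h1, h2]
  simp only [Matrix.mul_sub, Matrix.sub_mul, Matrix.trace_sub, Matrix.trace_smul, Matrix.mul_one,
    Matrix.one_mul, Matrix.trace_one, smul_eq_mul]
  simp only [Fintype.card_sum, Fintype.card_fin, Nat.cast_add]
  ring

lemma hessPen_of_comm {A : Matrix (Fin n ⊕ Fin n) (Fin n ⊕ Fin n) ℝ} {β δ m : ℝ}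
    (hZ : Jmat n * Z = Z * Jmat p) {Y : Matrix (Fin n ⊕ Fin n) (Fin p ⊕ Fin p) ℝ}
    (hY : Jmat n * Y = Y * Jmat p) (hAY : A * Y = δ • Y) (hZY : Zᵀ * Y = 0)
    (hYQ : Y * (Zᵀ * Z) = m • Y) :
    hessPen n p A β Z Y = (δ - β * (1 - m)) * frobSq Y := by
  have hYZ : Yᵀ * Z = 0 := by
    have := congrArg Matrix.transpose hZY
    simpa using this
  have h1 : Yᵀ * Jmat n * Z = 0 := by
    rw [Matrix.mul_assoc, hZ, ← Matrix.mul_assoc, hYZ, Matrix.zero_mul]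
  have h2 : Zᵀ * Jmat n * Y = 0 := by
    rw [Matrix.mul_assoc, hY, ← Matrix.mul_assoc, hZY, Matrix.zero_mul]
  have h3 : Yᵀ * Jmat n * Y * (Jmat p * (Zᵀ * Z - 1)) = (1 - m) • (Yᵀ * Y) := by
    rw [Matrix.mul_assoc Yᵀ, hY, Matrix.mul_assoc, Matrix.mul_assoc Y, Jmat_mul_Jmat_mul, neg_sub,
      Matrix.mul_sub, hYQ, Matrix.mul_one, sub_smul, one_smul, Matrix.mul_sub, Matrix.mul_smul]
  rw [hessPen, penalty_eq_of_comm hZ, h1, h2, h3, Matrix.mul_assoc, hAY, Matrix.mul_smul]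
  simp only [frobSq, Matrix.trace_smul, smul_eq_mul, add_zero, Matrix.mul_zero,
    Matrix.trace_zero]
  ring

lemma eq_zero_of_hessPen_nonneg {A : Matrix (Fin n ⊕ Fin n) (Fin n ⊕ Fin n) ℝ} {β δ m : ℝ}
    (hAJ : A * Jmat n = Jmat n * A) (hZ : Jmat n * Z = Z * Jmat p)
    (hess : ∀ Y, 0 ≤ hessPen n p A β Z Y) {v : Fin p ⊕ Fin p → ℝ} (hv0 : v ≠ 0)
    (hv : (Zᵀ * Z) *ᵥ v = m • v) {u : Fin n ⊕ Fin n → ℝ} (hu : Zᵀ *ᵥ u = 0)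
    (hAu : A *ᵥ u = δ • u) (hlt : δ < β * (1 - m)) : u = 0 := by
  obtain ⟨E, hE⟩ : ∃ E, E = Matrix.vecMulVec u v := ⟨_, rfl⟩
  have hAE : A * E = δ • E := by
    rw [hE, Matrix.mul_vecMulVec, hAu, Matrix.smul_vecMulVec]
  have hZE : Zᵀ * E = 0 := by rw [hE, Matrix.mul_vecMulVec, hu, Matrix.zero_vecMulVec]
  have hEQ : E * (Zᵀ * Z) = m • E := by
    have : v ᵥ* (Zᵀ * Z) = m • v := by
      rw [← Matrix.mulVec_transpose, Matrix.transpose_mul, Matrix.transpose_transpose, hv]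
    rw [hE, Matrix.vecMulVec_mul, this, Matrix.vecMulVec_smul]
  have hQ : Jmat p * (Zᵀ * Z) = Zᵀ * Z * Jmat p := by
    rw [← Matrix.mul_assoc, ← transpose_mul_Jmat hZ, Matrix.mul_assoc, hZ, Matrix.mul_assoc]
  have hY0 : E - Jmat n * E * Jmat p = 0 := by
    have h := hess (E - Jmat n * E * Jmat p)
    rw [hessPen_of_comm (δ := δ) (m := m) hZ] at h
    · refine frobSq_eq_zero (le_antisymm ?_ (frobSq_nonneg _))
      by_contra hpos
      push Not at hpos
      nlinarith
    · rw [Matrix.mul_sub, Matrix.sub_mul, Matrix.mul_assoc (Jmat n), Jmat_mul_Jmat_mul,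
        ← Matrix.mul_assoc, Matrix.mul_assoc _ (Jmat p), Jmat_mul_self]
      simp only [sub_neg_eq_add, Matrix.mul_neg, Matrix.mul_one]
      abel
    · rw [Matrix.mul_sub, hAE, ← Matrix.mul_assoc, ← Matrix.mul_assoc, hAJ,
        Matrix.mul_assoc (Jmat n) A, hAE, smul_sub, Matrix.mul_smul, Matrix.smul_mul]
    · rw [Matrix.mul_sub, hZE, ← Matrix.mul_assoc, ← Matrix.mul_assoc, transpose_mul_Jmat hZ,
        Matrix.mul_assoc (Jmat p), hZE]
      simp
    · rw [Matrix.sub_mul, hEQ, Matrix.mul_assoc _ (Jmat p), hQ, ← Matrix.mul_assoc,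
        Matrix.mul_assoc (Jmat n), hEQ, smul_sub, Matrix.mul_smul, Matrix.smul_mul]
  have hskew : v ⬝ᵥ (Jmat p *ᵥ v) = 0 := by
    have h1 : v ⬝ᵥ (Jmat p *ᵥ v) = -(v ⬝ᵥ (Jmat p *ᵥ v)) := by
      conv_lhs => rw [Matrix.dotProduct_mulVec, ← Matrix.mulVec_transpose, Jmat_transpose,
        Matrix.neg_mulVec, neg_dotProduct, dotProduct_comm]
    linarith
  have h1 := congrArg (fun B => B *ᵥ v) hY0
  simp only [Matrix.sub_mulVec, ← Matrix.mulVec_mulVec, hE, Matrix.vecMulVec_mulVec, hskew,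
    Matrix.zero_mulVec] at h1
  simpa [hv0, Matrix.mulVec_zero] using h1

end JmatComm

lemma sum_sq_mul_le {ι : Type*} [Fintype ι] [DecidableEq ι] {s : Finset ι} {g w : ι → ℝ} {c : ℝ}
    (hc : 0 ≤ c) (hw0 : ∀ i, 0 ≤ w i) (hw1 : ∀ i, w i ≤ 1) (hs : ∀ i ∈ s, c ≤ g i)
    (hns : ∀ i ∉ s, w i ≠ 0 → 0 ≤ g i ∧ g i ≤ c) (hsum : ∑ i, w i ≤ s.card) :
    ∑ i, g i ^ 2 * w i ≤ ∑ i ∈ s, g i ^ 2 := by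
  have key : ∑ i, g i ^ 2 * (w i - if i ∈ s then 1 else 0)
      ≤ ∑ i, c ^ 2 * (w i - if i ∈ s then 1 else 0) := by
    refine Finset.sum_le_sum fun i _ => ?_
    by_cases hi : i ∈ s
    · have h1 : c ^ 2 ≤ g i ^ 2 := pow_le_pow_left₀ hc (hs i hi) 2
      simp only [hi, if_true]
      nlinarith [hw1 i]
    · simp only [hi, if_false, sub_zero]
      by_cases hwi : w i = 0
      · simp [hwi]
      · obtain ⟨h0, h1⟩ := hns i hi hwi
        exact mul_le_mul_of_nonneg_right (pow_le_pow_left₀ h0 h1 2) (hw0 i)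
  rw [← Finset.mul_sum, Finset.sum_sub_distrib] at key
  simp only [mul_sub, Finset.sum_sub_distrib, mul_ite, mul_one, mul_zero, Finset.sum_ite_mem,
    Finset.univ_inter, Finset.sum_const, nsmul_eq_mul] at key
  nlinarith [sq_nonneg c]

lemma le_sum_sq_mul {ι : Type*} [Fintype ι] [DecidableEq ι] {s : Finset ι} {g w : ι → ℝ} {m : ℝ}
    (hm : 0 ≤ m) (hw0 : ∀ i, 0 ≤ w i) (hw1 : ∀ i, w i ≤ 1) (hs : ∀ i ∈ s, 0 ≤ g i)
    (hgt : ∀ i, m < g i → w i = 1) (hns : ∀ i, w i ≠ 0 → m ≤ g i)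
    (hsum : m ≠ 0 → ∑ i, w i = s.card) :
    ∑ i ∈ s, g i ^ 2 ≤ ∑ i, g i ^ 2 * w i := by
  have key : ∑ i, m ^ 2 * (w i - if i ∈ s then 1 else 0)
      ≤ ∑ i, g i ^ 2 * (w i - if i ∈ s then 1 else 0) := by
    refine Finset.sum_le_sum fun i _ => ?_
    by_cases hi : i ∈ s
    · simp only [hi, if_true]
      rcases lt_or_ge m (g i) with h | h
      · simp [hgt i h]
      · have h1 : g i ^ 2 ≤ m ^ 2 := pow_le_pow_left₀ (hs i hi) h 2
        nlinarith [hw1 i]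
    · simp only [hi, if_false, sub_zero]
      by_cases hwi : w i = 0
      · simp [hwi]
      · exact mul_le_mul_of_nonneg_right (pow_le_pow_left₀ hm (hns i hwi) 2) (hw0 i)
  rw [← Finset.mul_sum, Finset.sum_sub_distrib] at key
  simp only [mul_sub, Finset.sum_sub_distrib, mul_ite, mul_one, mul_zero, Finset.sum_ite_mem,
    Finset.univ_inter, Finset.sum_const, nsmul_eq_mul] at key
  by_cases h : m = 0
  · rw [h] at key
    linarith
  · rw [hsum h] at key
    linarith

section GramWeights

variable {ι κ : Type*} [Fintype ι] [DecidableEq ι] [Fintype κ]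
  {Z : Matrix ι κ ℝ} {g : ι → ℝ}

lemma trace_gram_sq (h : Z * (Zᵀ * Z) = diagonal g * Z) :
    trace (Zᵀ * Z * (Zᵀ * Z)) = ∑ i, g i * (Z * Zᵀ) i i := by
  rw [Matrix.mul_assoc, h, Matrix.trace_mul_comm, Matrix.mul_assoc]
  simp [Matrix.trace]

lemma exists_weights [DecidableEq κ] (h : Z * (Zᵀ * Z) = diagonal g * Z) :
    ∃ (q : κ → ℝ) (w : ι → ℝ), (∀ k, 0 ≤ q k) ∧
      (∀ k, ∃ v ≠ 0, (Zᵀ * Z) *ᵥ v = q k • v) ∧ (∀ i, 0 ≤ w i) ∧ (∀ i, w i ≤ 1) ∧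
      (∀ i, w i ≠ 0 → ∃ k, q k = g i) ∧ (∀ i, (Z * Zᵀ) i i = g i * w i) ∧
      (∑ i, w i ≤ Fintype.card κ) ∧ ((∀ k, q k ≠ 0) → ∑ i, w i = Fintype.card κ) := by
  have hpsd : (Zᵀ * Z).PosSemidef := by
    simpa using Matrix.posSemidef_conjTranspose_mul_self Z
  have hQ := hpsd.isHermitian
  obtain ⟨q, hq⟩ : ∃ q, q = hQ.eigenvalues := ⟨_, rfl⟩
  obtain ⟨V, hV⟩ : ∃ V : Matrix κ κ ℝ, V = hQ.eigenvectorUnitary := ⟨_, rfl⟩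
  have hVV : V * Vᵀ = 1 := by
    have := Matrix.mem_unitaryGroup_iff.1 hQ.eigenvectorUnitary.2
    rwa [← hV] at this
  have hVV' : Vᵀ * V = 1 := mul_eq_one_comm.1 hVV
  have hspec : Zᵀ * Z = V * diagonal q * Vᵀ := by
    have := hQ.spectral_theorem
    rw [Unitary.conjStarAlgAut_apply, ← hV] at this
    rw [hq]
    exact this
  obtain ⟨B, hB⟩ : ∃ B, B = Z * V := ⟨_, rfl⟩
  have hQV : Zᵀ * Z * V = V * diagonal q := by
    rw [hspec, Matrix.mul_assoc _ Vᵀ, hVV', Matrix.mul_one]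
  have hBB : Bᵀ * B = diagonal q := by
    rw [hB, Matrix.transpose_mul, Matrix.mul_assoc, ← Matrix.mul_assoc Zᵀ, hQV,
      ← Matrix.mul_assoc, hVV', Matrix.one_mul]
  have hGB : B * Bᵀ = Z * Zᵀ := by
    rw [hB, Matrix.transpose_mul, Matrix.mul_assoc, ← Matrix.mul_assoc V, hVV, Matrix.one_mul]
  have hgB : diagonal g * B = B * diagonal q := by
    rw [hB, ← Matrix.mul_assoc, ← h, Matrix.mul_assoc, hQV, Matrix.mul_assoc]
  have hq0 : ∀ k, 0 ≤ q k := fun k => hq ▸ hpsd.eigenvalues_nonneg k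
  have hcol : ∀ k, ∑ i, B i k ^ 2 = q k := fun k => by
    have := congrFun (congrFun hBB k) k
    simpa [Matrix.mul_apply, sq] using this
  have hrow : ∀ i, (Z * Zᵀ) i i = ∑ k, B i k ^ 2 := fun i => by
    rw [← hGB]
    simp [Matrix.mul_apply, sq]
  have hent : ∀ i k, B i k ≠ 0 → q k = g i ∧ 0 < q k := fun i k hne => by
    have h1 := congrFun (congrFun hgB i) k
    rw [Matrix.diagonal_mul, Matrix.mul_diagonal, mul_comm] at h1
    refine ⟨(mul_left_cancel₀ hne h1).symm, ?_⟩
    rw [← hcol k]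
    exact lt_of_lt_of_le (by positivity)
      (Finset.single_le_sum (f := fun i => B i k ^ 2) (fun _ _ => sq_nonneg _)
        (Finset.mem_univ i))
  have hG : ∀ i, (Z * Zᵀ) i i = g i * ∑ k, B i k ^ 2 / q k := fun i => by
    rw [hrow, Finset.mul_sum]
    refine Finset.sum_congr rfl fun k _ => ?_
    by_cases hne : B i k = 0
    · simp [hne]
    · obtain ⟨h1, h2⟩ := hent i k hne
      rw [← h1]
      field_simp
  have hw0 : ∀ i, 0 ≤ ∑ k, B i k ^ 2 / q k := fun i =>
    Finset.sum_nonneg fun k _ => div_nonneg (sq_nonneg _) (hq0 k)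
  have hex : ∀ i, ∑ k, B i k ^ 2 / q k ≠ 0 → ∃ k, q k = g i ∧ 0 < q k := fun i hne => by
    obtain ⟨k, -, hk⟩ := Finset.exists_ne_zero_of_sum_ne_zero hne
    exact ⟨k, hent i k fun h0 => hk (by simp [h0])⟩
  have hsum : ∑ i, ∑ k, B i k ^ 2 / q k = ∑ k, q k / q k := by
    rw [Finset.sum_comm]
    exact Finset.sum_congr rfl fun k _ => by rw [← Finset.sum_div, hcol]
  refine ⟨q, fun i => ∑ k, B i k ^ 2 / q k, hq0, fun k => ⟨fun l => V l k, ?_, ?_⟩, hw0,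
    fun i => ?_, fun i hne => (hex i hne).imp fun _ h => h.1, hG, ?_, fun hne => ?_⟩
  · intro h0
    have h1 := congrFun (congrFun hVV' k) k
    simp [Matrix.mul_apply, fun l => congrFun h0 l] at h1
  · ext l
    have h1 := congrFun (congrFun hQV l) k
    rw [Matrix.mul_diagonal, mul_comm] at h1
    exact h1
  · by_cases hne : ∑ k, B i k ^ 2 / q k = 0
    · simp [hne]
    · obtain ⟨k, h1, h2⟩ := hex i hne
      have hgi : 0 < g i := h1 ▸ h2
      have hsq : (Z * Zᵀ) i i ^ 2 ≤ g i * (Z * Zᵀ) i i := by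
        have e1 : (Z * Zᵀ * (Z * Zᵀ)) i i = g i * (Z * Zᵀ) i i := by
          rw [← Matrix.mul_assoc, Matrix.mul_assoc Z, h, Matrix.mul_assoc, Matrix.diagonal_mul]
        have e2 : (Z * Zᵀ * (Z * Zᵀ)) i i = ∑ l, (Z * Zᵀ) i l ^ 2 := by
          rw [Matrix.mul_apply]
          refine Finset.sum_congr rfl fun l _ => ?_
          have : (Z * Zᵀ) l i = (Z * Zᵀ) i l := by
            simp [Matrix.mul_apply, mul_comm]
          rw [this, sq]
        rw [← e1, e2]
        exact Finset.single_le_sum (f := fun l => (Z * Zᵀ) i l ^ 2) (fun _ _ => sq_nonneg _)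
          (Finset.mem_univ i)
      rw [hG i] at hsq
      have hpos : 0 < g i ^ 2 * ∑ k, B i k ^ 2 / q k :=
        mul_pos (pow_pos hgi 2) (lt_of_le_of_ne (hw0 i) (Ne.symm hne))
      refine le_of_mul_le_mul_left ?_ hpos
      linarith
  · rw [hsum]
    calc ∑ k, q k / q k ≤ ∑ _k : κ, (1 : ℝ) := Finset.sum_le_sum fun k _ => div_self_le_one _
      _ = Fintype.card κ := by simp
  · rw [hsum]
    simp [div_self (hne _)]

end GramWeights

section SecondOrder

variable {n p : ℕ} {r : Fin n} {d : Fin n → ℝ} {β : ℝ} {Z : Matrix (Fin n ⊕ Fin n) (Fin p ⊕ Fin p) ℝ}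

/-- The first `p` coordinates of each half of `Fin n ⊕ Fin n`. -/
def leadingIndices (n p : ℕ) : Finset (Fin n ⊕ Fin n) :=
  Finset.disjSum (Finset.univ.filter fun i : Fin n => i.val < p)
    (Finset.univ.filter fun i : Fin n => i.val < p)

lemma card_leadingIndices (hpn : p ≤ n) :
    (leadingIndices n p).card = Fintype.card (Fin p ⊕ Fin p) := by
  have : (Finset.univ.filter fun i : Fin n => i.val < p).card = p := by
    rw [Fin.card_filter_val_lt, min_eq_right hpn]
  rw [leadingIndices, Finset.card_disjSum, this]
  simp

/-- The relative gap `1 - dᵢ / β`, for the coordinates of both halves of `Fin n ⊕ Fin n`. -/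
def gap (d : Fin n → ℝ) (β : ℝ) (i : Fin n ⊕ Fin n) : ℝ := 1 - Sum.elim d d i / β

lemma gap_le_of_mem (hr : r.val + 1 = p) (hmono : Monotone d) (hβ : 0 < β)
    {i : Fin n ⊕ Fin n} (hi : i ∈ leadingIndices n p) :
    1 - d r / β ≤ gap d β i := by
  have key : ∀ i : Fin n, i.val < p → d i / β ≤ d r / β := fun i hi =>
    div_le_div_of_nonneg_right (hmono (Fin.le_def.2 (by omega))) hβ.le
  rcases i with i | i <;> simp [leadingIndices] at hi <;> exact sub_le_sub_left (key i hi) 1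

lemma gap_le_of_notMem (hr : r.val + 1 = p) (hmono : Monotone d) (hβ : 0 < β)
    {i : Fin n ⊕ Fin n} (hi : i ∉ leadingIndices n p) :
    gap d β i ≤ 1 - d r / β := by
  have key : ∀ i : Fin n, p ≤ i.val → d r / β ≤ d i / β := fun i hi =>
    div_le_div_of_nonneg_right (hmono (Fin.le_def.2 (by omega))) hβ.le
  rcases i with i | i <;> simp [leadingIndices] at hi <;> exact sub_le_sub_left (key i hi) 1

lemma diagonal_elim_eq (hβ : β ≠ 0) :
    diagonal (Sum.elim d d) = β • (1 - diagonal (gap d β)) := by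
  rw [← Matrix.diagonal_one, Matrix.diagonal_sub, ← Matrix.diagonal_smul]
  congr 1
  ext i
  simp only [gap, Pi.smul_apply, smul_eq_mul]
  field_simp
  ring

lemma mul_gram_eq_gap_mul (hβ : β ≠ 0)
    (h : diagonal (Sum.elim d d) * Z = β • (Z * (1 - Zᵀ * Z))) :
    Z * (Zᵀ * Z) = diagonal (gap d β) * Z := by
  rw [diagonal_elim_eq hβ, Matrix.smul_mul] at h
  have h1 := smul_right_injective _ hβ h
  beta_reduce at h1
  rw [Matrix.sub_mul, Matrix.mul_sub, Matrix.one_mul, Matrix.mul_one] at h1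
  exact (sub_right_injective h1).symm

lemma stationary_value_ge (hr : r.val + 1 = p) (hmono : Monotone d) (hd : ∀ i, 0 < d i)
    (hβ : d r < β) (hst : gradPen n p (diagonal (Sum.elim d d)) β Z = 0) :
    β / 2 * p - β / 4 * ∑ i ∈ leadingIndices n p, gap d β i ^ 2
      ≤ fPen n p (diagonal (Sum.elim d d)) β Z := by
  have hβ0 : 0 < β := (hd _).trans hβ
  have hZ := Jmat_comm_of_stationary hd hβ0 hst
  have hZQ := mul_gram_eq_gap_mul hβ0.ne' (mul_eq_of_stationary hZ hst)
  obtain ⟨q, w, hq0, -, hw0, hw1, hex, hG, hsum, -⟩ := exists_weights hZQ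
  rw [fPen_of_stationary hZ hst, trace_gram_sq hZQ]
  have h1 : ∑ i, gap d β i * (Z * Zᵀ) i i = ∑ i, gap d β i ^ 2 * w i :=
    Finset.sum_congr rfl fun i _ => by rw [hG i]; ring
  have h2 : ∑ i, gap d β i ^ 2 * w i ≤ ∑ i ∈ leadingIndices n p, gap d β i ^ 2 := by
    refine sum_sq_mul_le (c := 1 - d r / β) ?_ hw0 hw1
      (fun i hi => gap_le_of_mem hr hmono hβ0 hi)
      (fun i hi hwi => ⟨?_, gap_le_of_notMem hr hmono hβ0 hi⟩) ?_
    · rw [sub_nonneg, div_le_one hβ0]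
      exact hβ.le
    · obtain ⟨k, hk⟩ := hex i hwi
      exact hk ▸ hq0 k
    · rwa [card_leadingIndices (hr ▸ r.2)]
  rw [h1]
  gcongr

lemma gram_diag_eq_gap_of_hessPen_nonneg (hβ : 0 < β) (hZ : Jmat n * Z = Z * Jmat p)
    (hZQ : Z * (Zᵀ * Z) = diagonal (gap d β) * Z)
    (hess : ∀ Y, 0 ≤ hessPen n p (diagonal (Sum.elim d d)) β Z Y) {m : ℝ} (hm : 0 ≤ m)
    {v : Fin p ⊕ Fin p → ℝ} (hv0 : v ≠ 0) (hv : (Zᵀ * Z) *ᵥ v = m • v)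
    {i : Fin n ⊕ Fin n} (hi : m < gap d β i) : (Z * Zᵀ) i i = gap d β i := by
  have hg : 0 < gap d β i := hm.trans_lt hi
  obtain ⟨e, he⟩ : ∃ e : Fin n ⊕ Fin n → ℝ, e = Pi.single i 1 := ⟨_, rfl⟩
  have hge : diagonal (gap d β) *ᵥ e = gap d β i • e := by
    rw [he]
    ext l
    rw [Matrix.mulVec_diagonal]
    by_cases hl : l = i
    · subst hl; simp
    · simp [Pi.single_eq_of_ne hl]
  have hde : diagonal (Sum.elim d d) *ᵥ e = Sum.elim d d i • e := by
    rw [he]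
    ext l
    rw [Matrix.mulVec_diagonal]
    by_cases hl : l = i
    · subst hl; simp
    · simp [Pi.single_eq_of_ne hl]
  have hZQt : Zᵀ * (Z * Zᵀ) = Zᵀ * diagonal (gap d β) := by
    have := congrArg Matrix.transpose hZQ
    simpa [Matrix.mul_assoc] using this
  have hGg : diagonal (gap d β) * (Z * Zᵀ) = Z * Zᵀ * diagonal (gap d β) := by
    rw [← Matrix.mul_assoc, ← hZQ, Matrix.mul_assoc, Matrix.mul_assoc, hZQt, ← Matrix.mul_assoc]
  have hGd : diagonal (Sum.elim d d) * (Z * Zᵀ) = Z * Zᵀ * diagonal (Sum.elim d d) := by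
    rw [diagonal_elim_eq hβ.ne', Matrix.smul_mul, Matrix.mul_smul, Matrix.sub_mul,
      Matrix.mul_sub, hGg, Matrix.one_mul, Matrix.mul_one]
  have hu : e - (gap d β i)⁻¹ • ((Z * Zᵀ) *ᵥ e) = 0 := by
    refine eq_zero_of_hessPen_nonneg (diagonal_mul_Jmat d) hZ hess hv0 hv (δ := Sum.elim d d i)
      ?_ ?_ ?_
    · rw [Matrix.mulVec_sub, Matrix.mulVec_smul, Matrix.mulVec_mulVec, hZQt,
        ← Matrix.mulVec_mulVec, hge, Matrix.mulVec_smul, smul_smul, inv_mul_cancel₀ hg.ne',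
        one_smul, sub_self]
    · rw [Matrix.mulVec_sub, Matrix.mulVec_smul, Matrix.mulVec_mulVec, hGd,
        ← Matrix.mulVec_mulVec, hde, Matrix.mulVec_smul, smul_sub, smul_comm]
    · have : Sum.elim d d i = β * (1 - gap d β i) := by
        simp only [gap]
        field_simp
        ring
      rw [this]
      nlinarith
  have h1 := congrFun hu i
  have h2 : ((Z * Zᵀ) *ᵥ e) i = (Z * Zᵀ) i i := by rw [he]; simp
  simp only [Pi.sub_apply, Pi.smul_apply, Pi.zero_apply, smul_eq_mul, h2] at h1
  rw [he, Pi.single_eq_same] at h1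
  field_simp at h1
  linarith

lemma second_order_value_le (hr : r.val + 1 = p) (hmono : Monotone d) (hd : ∀ i, 0 < d i)
    (hβ : d r < β) (hst : gradPen n p (diagonal (Sum.elim d d)) β Z = 0)
    (hess : ∀ Y, 0 ≤ hessPen n p (diagonal (Sum.elim d d)) β Z Y) :
    fPen n p (diagonal (Sum.elim d d)) β Z
      ≤ β / 2 * p - β / 4 * ∑ i ∈ leadingIndices n p, gap d β i ^ 2 := by
  have hβ0 : 0 < β := (hd _).trans hβ
  have hZ := Jmat_comm_of_stationary hd hβ0 hst
  have hZQ := mul_gram_eq_gap_mul hβ0.ne' (mul_eq_of_stationary hZ hst)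
  obtain ⟨q, w, hq0, heig, hw0, hw1, hex, hG, -, hsum⟩ := exists_weights hZQ
  rw [fPen_of_stationary hZ hst, trace_gram_sq hZQ]
  have h1 : ∑ i, gap d β i * (Z * Zᵀ) i i = ∑ i, gap d β i ^ 2 * w i :=
    Finset.sum_congr rfl fun i _ => by rw [hG i]; ring
  have : Nonempty (Fin p ⊕ Fin p) := ⟨Sum.inl ⟨r, by omega⟩⟩
  obtain ⟨k, hk⟩ := Finite.exists_min q
  obtain ⟨v, hv0, hv⟩ := heig k
  have h2 : ∑ i ∈ leadingIndices n p, gap d β i ^ 2 ≤ ∑ i, gap d β i ^ 2 * w i := by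
    refine le_sum_sq_mul (m := q k) (hq0 k) hw0 hw1 (fun i hi => ?_) (fun i hi => ?_)
      (fun i hwi => ?_) (fun hm => ?_)
    · refine le_trans ?_ (gap_le_of_mem hr hmono hβ0 hi)
      rw [sub_nonneg, div_le_one hβ0]
      exact hβ.le
    · have h3 := gram_diag_eq_gap_of_hessPen_nonneg hβ0 hZ hZQ hess (hq0 k) hv0 hv hi
      rw [hG i] at h3
      exact mul_left_cancel₀ ((hq0 k).trans_lt hi).ne' (h3.trans (mul_one _).symm)
    · obtain ⟨l, hl⟩ := hex i hwi
      exact hl ▸ hk l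
    · rw [card_leadingIndices (hr ▸ r.2)]
      exact hsum fun l => (((hq0 k).lt_of_ne (Ne.symm hm)).trans_le (hk l)).ne'
  rw [h1]
  gcongr

theorem fPen_diagonal_le_of_second_order (hr : r.val + 1 = p) (hmono : Monotone d)
    (hd : ∀ i, 0 < d i) (hβ : d r < β)
    (hst : gradPen n p (diagonal (Sum.elim d d)) β Z = 0)
    (hess : ∀ Y, 0 ≤ hessPen n p (diagonal (Sum.elim d d)) β Z Y)
    (Y : Matrix (Fin n ⊕ Fin n) (Fin p ⊕ Fin p) ℝ) :
    fPen n p (diagonal (Sum.elim d d)) β Z ≤ fPen n p (diagonal (Sum.elim d d)) β Y := by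
  have hδ : ∀ i, 0 < Sum.elim d d i := by rintro (i | i) <;> exact hd i
  obtain ⟨Z₀, hZ₀⟩ := exists_forall_fPen_diagonal_le (p := p) ((hd _).trans hβ).le hδ
  have hst₀ := (IsLocalMin.fPen_conditions (Matrix.diagonal_transpose _)
    (Filter.Eventually.of_forall hZ₀)).1
  exact (second_order_value_le hr hmono hd hβ hst hess).trans
    ((stationary_value_ge hr hmono hd hβ hst₀).trans (hZ₀ Y))

end SecondOrder

section Congruence

variable {n p : ℕ} {A S : Matrix (Fin n ⊕ Fin n) (Fin n ⊕ Fin n) ℝ}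

lemma transpose_mul_mul_congr {m k : Type*} [Fintype m] [Fintype k] (S B : Matrix m m ℝ)
    (X Y : Matrix m k ℝ) : (S * X)ᵀ * B * (S * Y) = Xᵀ * (Sᵀ * B * S) * Y := by
  simp only [Matrix.transpose_mul, Matrix.mul_assoc]

lemma fPen_congr (hS : Sᵀ * Jmat n * S = Jmat n) (β : ℝ)
    (Z : Matrix (Fin n ⊕ Fin n) (Fin p ⊕ Fin p) ℝ) :
    fPen n p A β (S * Z) = fPen n p (Sᵀ * A * S) β Z := by
  simp only [fPen, transpose_mul_mul_congr, hS]

lemma hessPen_congr (hS : Sᵀ * Jmat n * S = Jmat n) (β : ℝ)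
    (Z Y : Matrix (Fin n ⊕ Fin n) (Fin p ⊕ Fin p) ℝ) :
    hessPen n p A β (S * Z) (S * Y) = hessPen n p (Sᵀ * A * S) β Z Y := by
  simp only [hessPen, transpose_mul_mul_congr, hS]

lemma gradPen_congr (hS : Sᵀ * Jmat n * S = Jmat n) (β : ℝ)
    (Z : Matrix (Fin n ⊕ Fin n) (Fin p ⊕ Fin p) ℝ) :
    gradPen n p (Sᵀ * A * S) β Z = Sᵀ * gradPen n p A β (S * Z) := by
  simp only [gradPen, transpose_mul_mul_congr, hS, Matrix.mul_sub, Matrix.mul_smul]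
  simp only [← Matrix.mul_assoc, hS]

lemma exists_eq_mul_of_symplectic (hS : Sᵀ * Jmat n * S = Jmat n)
    (X : Matrix (Fin n ⊕ Fin n) (Fin p ⊕ Fin p) ℝ) :
    ∃ Z : Matrix (Fin n ⊕ Fin n) (Fin p ⊕ Fin p) ℝ, X = S * Z := by
  have h1 : -(Jmat n * Sᵀ * Jmat n) * S = 1 := by
    rw [Matrix.neg_mul, Matrix.mul_assoc, Matrix.mul_assoc, ← Matrix.mul_assoc Sᵀ, hS,
      Jmat_mul_self, neg_neg]
  exact ⟨-(Jmat n * Sᵀ * Jmat n) * X, by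
    rw [← Matrix.mul_assoc, mul_eq_one_comm.1 h1, Matrix.one_mul]⟩

end Congruence

theorem stmt16 (n p : ℕ) (hp : 1 ≤ p) (hpn : p ≤ n)
    (A : Matrix (Fin n ⊕ Fin n) (Fin n ⊕ Fin n) ℝ) (hA : A.PosDef)
    (d : Fin n → ℝ) (hmono : Monotone d) (hdpos : ∀ i, 0 < d i)
    (S₀ : Matrix (Fin n ⊕ Fin n) (Fin n ⊕ Fin n) ℝ)
    (hS₀symp : S₀ᵀ * Jmat n * S₀ = Jmat n)
    (hS₀diag : S₀ᵀ * A * S₀ = Matrix.diagonal (Sum.elim d d))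
    (β : ℝ) (hβ : d ⟨p - 1, by omega⟩ < β)
    (X : Matrix (Fin n ⊕ Fin n) (Fin p ⊕ Fin p) ℝ)
    (hstat : gradPen n p A β X = 0)
    (hnotglobal : ¬ ∀ Y, fPen n p A β X ≤ fPen n p A β Y) :
    (∃ Y : Matrix (Fin n ⊕ Fin n) (Fin p ⊕ Fin p) ℝ,
      Matrix.trace (Yᵀ * A * Y)
        - β * Matrix.trace ((Yᵀ * Jmat n * Y) * (Xᵀ * Jmat n * X - Jmat p))
        + (β / 2) * frobSq (Yᵀ * Jmat n * X + Xᵀ * Jmat n * Y) < 0) ∧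
    ¬ IsLocalMin (fPen n p A β) X := by
  have hneg : ∃ Y, hessPen n p A β X Y < 0 := by
    by_contra! hess
    obtain ⟨Z, rfl⟩ := exists_eq_mul_of_symplectic hS₀symp X
    refine hnotglobal fun Y => ?_
    obtain ⟨Y, rfl⟩ := exists_eq_mul_of_symplectic hS₀symp Y
    rw [fPen_congr hS₀symp, fPen_congr hS₀symp, hS₀diag]
    refine fPen_diagonal_le_of_second_order (Nat.sub_add_cancel hp) hmono hdpos hβ ?_ (fun Y => ?_) Y
    · rw [← hS₀diag, gradPen_congr hS₀symp, hstat, Matrix.mul_zero]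
    · rw [← hS₀diag, ← hessPen_congr hS₀symp]
      exact hess _
  refine ⟨hneg, fun hmin => ?_⟩
  obtain ⟨Y, hY⟩ := hneg
  have hAt : Aᵀ = A := by
    rw [← Matrix.conjTranspose_eq_transpose_of_trivial]
    exact hA.isHermitian
  exact hY.not_ge ((hmin.fPen_conditions hAt).2 Y)
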